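/- Let q be a prime power, ε > 0, and let A_n be chosen uniformly at random from GL_n(F_q). Let M_{n'} be the top left n' × n' corner of A_n, where n' ≤ (1 − ε)n. Let Q(M_{n'}) = n' − rank(M_{n'}), and let Q_∞ be the distribution with P(Q_∞ = k) = q^{-k²} · (∏_{i=k+1}^∞ (1 − q^{-i})) / (∏_{i=1}^{k} (1 − q^{-i})). Then ‖Q(M_{n'}) − Q_∞‖_TV ≤ 3/q^{n'} + 2^{min(n', εn)+1}/q^{εn}. -/

import Mathlib

open MeasureTheory ProbabilityTheory Matrix

/-- The limiting corank distribution `Q_∞` for square matrices over a field with `q` elements. -/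
noncomputable def Qinf (q : ℝ) (k : ℕ) : ℝ :=
  (q ^ (k ^ 2))⁻¹ * (∏' i : ℕ, (1 - (q ^ (k + 1 + i))⁻¹)) /
    ∏ i ∈ Finset.range k, (1 - (q ^ (i + 1))⁻¹)

/-- Total variation distance between the law of the ℕ-valued random variable `Q` and the
distribution on ℕ with density `f`. -/
noncomputable def tvDist {Ω : Type*} [MeasureSpace Ω] (Q : Ω → ℕ) (f : ℕ → ℝ) : ℝ :=
  ⨆ A : Set ℕ, |(ℙ (Q ⁻¹' A)).toReal - ∑' k : A, f k|

section

open Finset Filter Topology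

/-- The finite product `∏_{i=1}^{j} (1 - q^{-i})`. -/
noncomputable def qProd (q : ℝ) (j : ℕ) : ℝ := ∏ i ∈ range j, (1 - (q ^ (i + 1))⁻¹)

lemma qProd_succ (q : ℝ) (j : ℕ) : qProd q (j + 1) = qProd q j * (1 - (q ^ (j + 1))⁻¹) :=
  prod_range_succ _ _

lemma inv_pow_succ_le_half {q : ℝ} (hq : 2 ≤ q) (i : ℕ) : (q ^ (i + 1))⁻¹ ≤ 1 / 2 := by
  rw [one_div]
  apply inv_anti₀ two_pos
  exact hq.trans (le_self_pow₀ (by linarith) (by omega))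

lemma qProd_pos {q : ℝ} (hq : 2 ≤ q) (j : ℕ) : 0 < qProd q j :=
  prod_pos fun i _ => by linarith [inv_pow_succ_le_half hq i]

lemma qProd_add_ge {q : ℝ} (hq : 2 ≤ q) (m j : ℕ) :
    qProd q m * (1 - (q ^ m)⁻¹ + (q ^ (m + j))⁻¹) ≤ qProd q (m + j) := by
  induction j with
  | zero => simp
  | succ j ih =>
    have hy : 0 < (q ^ (m + j))⁻¹ := by positivity
    have hym : (q ^ (m + j))⁻¹ ≤ (q ^ m)⁻¹ := by
      apply inv_anti₀ (by positivity)
      exact pow_le_pow_right₀ (by linarith) (by omega)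
    have hx : q⁻¹ ≤ 1 / 2 := by simpa using inv_pow_succ_le_half hq 0
    have hx0 : 0 < q⁻¹ := by positivity
    have hz := inv_pow_succ_le_half hq (m + j)
    rw [← add_assoc, qProd_succ]
    refine le_trans ?_ (mul_le_mul_of_nonneg_right ih (by linarith))
    rw [mul_assoc]
    apply mul_le_mul_of_nonneg_left _ (qProd_pos hq m).le
    have e : (q ^ (m + j + 1))⁻¹ = (q ^ (m + j))⁻¹ * q⁻¹ := by rw [pow_succ, mul_inv]
    rw [e]
    generalize (q ^ (m + j))⁻¹ = y at *
    generalize (q ^ m)⁻¹ = w at *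
    generalize q⁻¹ = x at *
    nlinarith [mul_pos hy hx0, mul_nonneg (mul_pos hy hx0).le (sub_nonneg.2 hym)]

lemma qProd_antitone {q : ℝ} (hq : 2 ≤ q) : Antitone (qProd q) := by
  refine antitone_nat_of_succ_le fun j => ?_
  rw [qProd_succ]
  refine mul_le_of_le_one_right (qProd_pos hq j).le ?_
  have : 0 < (q ^ (j + 1))⁻¹ := by positivity
  linarith

lemma multipliable_one_sub_inv_pow {q : ℝ} (hq : 2 ≤ q) (k : ℕ) :
    Multipliable fun i : ℕ => 1 - (q ^ (k + i))⁻¹ := by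
  have hs : Summable fun i : ℕ => -(q ^ (k + i))⁻¹ := by
    have h : Summable fun i : ℕ => (q⁻¹) ^ i :=
      summable_geometric_of_lt_one (by positivity) (inv_lt_one_of_one_lt₀ (by linarith))
    refine (h.mul_left (-(q ^ k)⁻¹)).congr fun i => ?_
    rw [pow_add, mul_inv, inv_pow, neg_mul]
  simpa [sub_eq_add_neg] using Real.multipliable_one_add_of_summable hs

/-- The infinite product `∏_{i ≥ 1} (1 - q^{-i})`. -/
noncomputable def qProdInf (q : ℝ) : ℝ := ∏' i : ℕ, (1 - (q ^ (0 + 1 + i))⁻¹)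

lemma tendsto_qProd_add {q : ℝ} (hq : 2 ≤ q) (k : ℕ) :
    Tendsto (fun j => qProd q (k + j)) atTop
      (𝓝 (qProd q k * ∏' i : ℕ, (1 - (q ^ (k + 1 + i))⁻¹))) := by
  have h := ((multipliable_one_sub_inv_pow hq (k + 1)).hasProd.tendsto_prod_nat).const_mul
    (qProd q k)
  refine h.congr fun j => ?_
  rw [qProd, qProd, prod_range_add]
  simp only [add_right_comm]

lemma tendsto_qProd {q : ℝ} (hq : 2 ≤ q) : Tendsto (qProd q) atTop (𝓝 (qProdInf q)) := by
  have h := tendsto_qProd_add hq 0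
  simp only [zero_add, show qProd q 0 = 1 from prod_range_zero _, one_mul] at h
  simpa only [qProdInf, zero_add] using h

lemma qProd_mul_tprod {q : ℝ} (hq : 2 ≤ q) (k : ℕ) :
    qProd q k * ∏' i : ℕ, (1 - (q ^ (k + 1 + i))⁻¹) = qProdInf q := by
  refine tendsto_nhds_unique (tendsto_qProd_add hq k) ?_
  have := (tendsto_add_atTop_iff_nat k).2 (tendsto_qProd hq)
  simpa only [add_comm] using this

lemma Qinf_eq {q : ℝ} (hq : 2 ≤ q) (k : ℕ) :
    Qinf q k = (q ^ (k ^ 2))⁻¹ * (qProdInf q / qProd q k ^ 2) := by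
  have h := (qProd_pos hq k).ne'
  rw [← qProd_mul_tprod hq k, Qinf]
  change _ / qProd q k = _
  field_simp

lemma qProd_mul_le_qProdInf {q : ℝ} (hq : 2 ≤ q) (m : ℕ) :
    qProd q m * (1 - (q ^ m)⁻¹) ≤ qProdInf q := by
  refine ge_of_tendsto (tendsto_qProd hq) ?_
  filter_upwards [eventually_ge_atTop m] with j hj
  obtain ⟨j, rfl⟩ := Nat.exists_eq_add_of_le hj
  refine le_trans ?_ (qProd_add_ge hq m j)
  have : 0 < (q ^ (m + j))⁻¹ := by positivity
  exact mul_le_mul_of_nonneg_left (by linarith) (qProd_pos hq m).le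

lemma qProdInf_pos {q : ℝ} (hq : 2 ≤ q) : 0 < qProdInf q := by
  refine lt_of_lt_of_le (mul_pos (qProd_pos hq 1) ?_) (qProd_mul_le_qProdInf hq 1)
  linarith [inv_pow_succ_le_half hq 0]

lemma le_mul_one_add_of_mul_one_sub_le {a b x : ℝ} (ha : 0 < a) (hx : 0 ≤ x) (hx' : x ≤ 1 / 2)
    (h : a * (1 - x) ≤ b) : a ≤ b * (1 + 2 * x) := by
  nlinarith [mul_nonneg ha.le (mul_nonneg hx (sub_nonneg.2 hx')),
    mul_le_mul_of_nonneg_right h (show 0 ≤ 1 + 2 * x by linarith)]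

lemma qProd_le_qProdInf_mul {q : ℝ} (hq : 2 ≤ q) (m : ℕ) :
    qProd q (m + 1) ≤ qProdInf q * (1 + 2 * (q ^ (m + 1))⁻¹) :=
  le_mul_one_add_of_mul_one_sub_le (qProd_pos hq _) (by positivity) (inv_pow_succ_le_half hq m)
    (qProd_mul_le_qProdInf hq _)

/-- The product `∏_{i < r} (q^m - q^i)`. -/
noncomputable def qDesc (q : ℝ) (m r : ℕ) : ℝ := ∏ i ∈ range r, (q ^ m - q ^ i)

lemma qDesc_succ (q : ℝ) (m r : ℕ) : qDesc q m (r + 1) = qDesc q m r * (q ^ m - q ^ r) :=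
  prod_range_succ _ _

lemma qDesc_succ_succ (q : ℝ) (m r : ℕ) :
    qDesc q (m + 1) (r + 1) = (q ^ (m + 1) - 1) * q ^ r * qDesc q m r := by
  rw [qDesc, prod_range_succ', qDesc]
  have : ∀ i ∈ range r, q ^ (m + 1) - q ^ (i + 1) = q * (q ^ m - q ^ i) := fun i _ => by ring
  rw [prod_congr rfl this, prod_mul_distrib]
  simp
  ring

lemma qDesc_mul_qProd {q : ℝ} (hq : 2 ≤ q) (k r : ℕ) :
    qDesc q (k + r) r * qProd q k = q ^ ((k + r) * r) * qProd q (k + r) := by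
  induction r with
  | zero => simp [qDesc]
  | succ r ih =>
    have h : q ^ (k + r + 1) ≠ 0 := by positivity
    rw [← add_assoc, qDesc_succ_succ, mul_assoc, ih, qProd_succ]
    have : 1 - (q ^ (k + r + 1))⁻¹ = (q ^ (k + r + 1) - 1) * (q ^ (k + r + 1))⁻¹ := by
      field_simp
    rw [this]
    field_simp
    ring

open Submodule in
lemma finrank_span_cons {K V : Type*} [Field K] [AddCommGroup V] [Module K V]
    [FiniteDimensional K V] {m : ℕ} (x : V) (v : Fin m → V) [Decidable (x ∈ span K (Set.range v))] :
    Module.finrank K (span K (Set.range (Fin.cons x v : Fin (m + 1) → V))) =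
      Module.finrank K (span K (Set.range v)) + if x ∈ span K (Set.range v) then 0 else 1 := by
  rw [Fin.range_cons]
  split_ifs with h
  · rw [span_insert_eq_span h, add_zero]
  · rw [span_insert]
    have hx : x ≠ 0 := fun h0 => h (h0 ▸ zero_mem _)
    have hd : span K {x} ⊓ span K (Set.range v) = ⊥ := by
      rw [← disjoint_iff, disjoint_comm, disjoint_span_singleton' hx]
      exact h
    have := finrank_sup_add_finrank_inf_eq (span K {x}) (span K (Set.range v))
    rw [hd, finrank_bot, add_zero, finrank_span_singleton hx] at this
    rw [this, add_comm]

/-- The number of `m`-tuples of vectors of `V` spanning a subspace of dimension `r`. -/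
noncomputable def numTuples (K V : Type*) [Field K] [AddCommGroup V] [Module K V] [Fintype V]
    (m r : ℕ) : ℕ :=
  #{v : Fin m → V | Module.finrank K (Submodule.span K (Set.range v)) = r}

lemma numTuples_succ_eq_sum {K V : Type*} [Field K] [AddCommGroup V] [Module K V] [Fintype V]
    (m r : ℕ) :
    numTuples K V (m + 1) r = ∑ v : Fin m → V, #{x : V | Module.finrank K
      (Submodule.span K (Set.range (Fin.cons x v : Fin (m + 1) → V))) = r} := by
  classical
  simp only [numTuples, card_filter]
  rw [← (Fin.consEquiv fun _ => V).sum_comp, Fintype.sum_prod_type_right]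
  rfl

section Tuples

variable {K V : Type*} [Field K] [Fintype K] [AddCommGroup V] [Module K V] [Fintype V]

lemma card_mem_submodule (W : Submodule K V) [DecidablePred (· ∈ W)] :
    #{x : V | x ∈ W} = Fintype.card K ^ Module.finrank K W := by
  rw [← Module.card_eq_pow_finrank, Fintype.card_subtype]

open Classical in
lemma card_finrank_span_cons {m : ℕ} (v : Fin m → V) (r : ℕ) :
    (#{x : V | Module.finrank K
      (Submodule.span K (Set.range (Fin.cons x v : Fin (m + 1) → V))) = r} : ℝ) =
      (if Module.finrank K (Submodule.span K (Set.range v)) = r then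
        (Fintype.card K : ℝ) ^ r else 0) +
      (if Module.finrank K (Submodule.span K (Set.range v)) + 1 = r then
        (Fintype.card K : ℝ) ^ Module.finrank K V -
          (Fintype.card K : ℝ) ^ Module.finrank K (Submodule.span K (Set.range v)) else 0) := by
  have hin := card_mem_submodule (Submodule.span K (Set.range v))
  have hout := card_filter_add_card_filter_not (s := univ)
    (fun x : V => x ∈ Submodule.span K (Set.range v))
  rw [hin, card_univ, Module.card_eq_pow_finrank (K := K) (V := V)] at hout
  simp only [finrank_span_cons]
  set W := Submodule.span K (Set.range v)
  by_cases h1 : Module.finrank K W = r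
  · subst h1
    simp [hin]
  · by_cases h2 : Module.finrank K W + 1 = r
    · subst h2
      have : ∀ x : V, (Module.finrank K W + (if x ∈ W then 0 else 1) = Module.finrank K W + 1) ↔
          x ∉ W := fun x => by split_ifs <;> simp [*]
      simp only [this, h1, if_false, if_true]
      rw [zero_add, eq_sub_iff_add_eq, add_comm]
      exact_mod_cast hout
    · have : ∀ x : V, ¬ (Module.finrank K W + (if x ∈ W then 0 else 1) = r) := fun x => by
        split_ifs <;> omega
      simp [this, h1, h2]

lemma numTuples_succ_zero (m : ℕ) : numTuples K V (m + 1) 0 = numTuples K V m 0 := by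
  classical
  rw [← Nat.cast_inj (R := ℝ), numTuples_succ_eq_sum]
  push_cast
  simp only [card_finrank_span_cons, numTuples, Nat.succ_ne_zero, if_false, add_zero, pow_zero]
  rw [← sum_filter, sum_const, nsmul_one]

lemma numTuples_succ_succ (m r : ℕ) :
    (numTuples K V (m + 1) (r + 1) : ℝ) =
      (Fintype.card K : ℝ) ^ (r + 1) * numTuples K V m (r + 1) +
      ((Fintype.card K : ℝ) ^ Module.finrank K V - (Fintype.card K : ℝ) ^ r) *
        numTuples K V m r := by
  classical
  rw [numTuples_succ_eq_sum]
  push_cast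
  simp only [card_finrank_span_cons, sum_add_distrib, numTuples, Nat.add_right_cancel_iff]
  congr 1
  · rw [← sum_filter, sum_const, nsmul_eq_mul, mul_comm]
  · rw [← sum_filter, sum_congr rfl (g := fun _ => (Fintype.card K : ℝ) ^ Module.finrank K V -
      (Fintype.card K : ℝ) ^ r), sum_const, nsmul_eq_mul, mul_comm]
    intro v hv
    rw [(mem_filter.1 hv).2]

lemma numTuples_mul_qDesc (m r : ℕ) :
    (numTuples K V m r : ℝ) * qDesc (Fintype.card K) r r =
      qDesc (Fintype.card K) m r * qDesc (Fintype.card K) (Module.finrank K V) r := by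
  induction m generalizing r with
  | zero =>
    have h : ∀ v : Fin 0 → V, Module.finrank K (Submodule.span K (Set.range v)) = 0 := by
      intro v; simp
    rcases r with _ | r
    · simp [numTuples, h, qDesc]
    · simp [numTuples, h, qDesc, prod_range_succ']
  | succ m ih =>
    rcases r with _ | r
    · rw [numTuples_succ_zero, ih]
      simp [qDesc]
    · have h1 := ih (r + 1)
      rw [numTuples_succ_succ, add_mul, mul_assoc, h1, qDesc_succ_succ _ r r, mul_assoc,
        mul_left_comm _ _ (qDesc _ r r), ih r, qDesc_succ_succ, qDesc_succ _ m,
        qDesc_succ _ (Module.finrank K V)]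
      ring

end Tuples

open Classical in
/-- The proportion of the `N × N` matrices over `F` whose corank lies in `S`. -/
noncomputable def corankProb (F : Type*) [Field F] [Fintype F] (N : ℕ) (S : Set ℕ) : ℝ :=
  #{M : Matrix (Fin N) (Fin N) F | N - M.rank ∈ S} / (Fintype.card F : ℝ) ^ (N ^ 2)

lemma card_matrix_fin (F : Type*) [Fintype F] (N : ℕ) :
    Fintype.card (Matrix (Fin N) (Fin N) F) = Fintype.card F ^ (N ^ 2) := by
  classical
  rw [← Nat.card_eq_fintype_card]
  simp [Matrix, ← pow_mul, sq]

section Corank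

variable (F : Type*) [Field F] [Fintype F]

lemma two_le_card_real : (2 : ℝ) ≤ Fintype.card F := by
  exact_mod_cast Fintype.one_lt_card (α := F)

lemma qDesc_pos {q : ℝ} (hq : 2 ≤ q) (r : ℕ) : 0 < qDesc q r r :=
  prod_pos fun i hi => sub_pos.2 (pow_lt_pow_right₀ (by linarith) (mem_range.1 hi))

lemma corankProb_singleton (k r : ℕ) :
    corankProb F (k + r) {k} = ((Fintype.card F : ℝ) ^ (k ^ 2))⁻¹ *
      (qProd (Fintype.card F) (k + r) ^ 2 /
        (qProd (Fintype.card F) k ^ 2 * qProd (Fintype.card F) r)) := by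
  classical
  have hq := two_le_card_real F
  have hn : corankProb F (k + r) {k} = numTuples F (Fin (k + r) → F) (k + r) r /
      (Fintype.card F : ℝ) ^ ((k + r) ^ 2) := by
    unfold corankProb numTuples
    congr 2
    refine card_equiv Matrix.of.symm fun M => ?_
    have h := M.rank_le_width
    have h' : M.rank =
        Module.finrank F (Submodule.span F (Set.range (Matrix.of.symm M))) :=
      M.rank_eq_finrank_span_row
    simp only [mem_filter, mem_univ, true_and, Set.mem_singleton_iff]
    rw [← h']
    omega
  have h := numTuples_mul_qDesc (K := F) (V := Fin (k + r) → F) (k + r) r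
  rw [Module.finrank_fin_fun] at h
  have h1 := qDesc_mul_qProd hq k r
  have h2 := qDesc_mul_qProd hq 0 r
  simp only [zero_add, show qProd (Fintype.card F : ℝ) 0 = 1 from prod_range_zero _, mul_one] at h2
  have hk := qProd_pos hq k
  have hr := qProd_pos hq r
  have hd := qDesc_pos hq r
  rw [hn, eq_div_of_mul_eq hd.ne' h, eq_div_of_mul_eq hk.ne' h1, h2]
  have : (0 : ℝ) < Fintype.card F := by linarith
  field_simp
  ring

lemma corankProb_le_Qinf (N k : ℕ) (hk : k ≤ N + 1) :
    corankProb F (N + 1) {k} ≤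
      Qinf (Fintype.card F) k * (1 + 2 * ((Fintype.card F : ℝ) ^ (N + 1))⁻¹) := by
  have hq := two_le_card_real F
  obtain ⟨r, hr⟩ := Nat.exists_eq_add_of_le hk
  have hle := qProd_le_qProdInf_mul hq N
  rw [hr] at hle ⊢
  rw [corankProb_singleton, Qinf_eq hq, mul_assoc]
  refine mul_le_mul_of_nonneg_left ?_ (by positivity)
  have h1 := qProd_pos hq k
  have h2 := qProd_pos hq r
  have h5 := qProdInf_pos hq
  have h3 := qProd_pos hq (k + r)
  have h4 := qProd_antitone hq (Nat.le_add_left r k)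
  rw [div_mul_eq_mul_div, div_le_div_iff₀ (by positivity) (by positivity)]
  calc qProd (Fintype.card F) (k + r) ^ 2 * qProd (Fintype.card F) k ^ 2
      = qProd (Fintype.card F) (k + r) * qProd (Fintype.card F) (k + r) *
          qProd (Fintype.card F) k ^ 2 := by ring
    _ ≤ _ := by
      rw [mul_comm (qProd (Fintype.card F : ℝ) k ^ 2), ← mul_assoc]
      gcongr

lemma tendsto_corankProb (k : ℕ) :
    Tendsto (fun N => corankProb F N {k}) atTop (𝓝 (Qinf (Fintype.card F) k)) := by
  have hq := two_le_card_real F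
  rw [← tendsto_add_atTop_iff_nat k]
  simp only [add_comm _ k, corankProb_singleton, Qinf_eq hq]
  refine Tendsto.const_mul _ ?_
  have hI := (qProdInf_pos hq).ne'
  have hk := (qProd_pos hq k).ne'
  have h1 : Tendsto (fun r => qProd (Fintype.card F) (k + r)) atTop
      (𝓝 (qProdInf (Fintype.card F))) := by
    rw [← qProd_mul_tprod hq k]
    exact tendsto_qProd_add hq k
  have h := (h1.pow 2).div ((tendsto_qProd hq).const_mul (qProd (Fintype.card F) k ^ 2))
    (by positivity)
  have e : qProdInf (Fintype.card F) ^ 2 /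
      (qProd (Fintype.card F) k ^ 2 * qProdInf (Fintype.card F)) =
      qProdInf (Fintype.card F) / qProd (Fintype.card F) k ^ 2 := by
    field_simp
  rwa [e] at h

lemma corankProb_nonneg (N : ℕ) (S : Set ℕ) : 0 ≤ corankProb F N S := by
  unfold corankProb
  positivity

lemma corankProb_le_one (N : ℕ) (S : Set ℕ) : corankProb F N S ≤ 1 := by
  classical
  have hq := two_le_card_real F
  rw [corankProb, div_le_one (by positivity)]
  refine le_trans (Nat.cast_le.2 (card_le_univ _)) ?_
  rw [card_matrix_fin, Nat.cast_pow]

open Classical in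
lemma corankProb_eq_sum (N : ℕ) (S : Set ℕ) (t : Finset ℕ)
    (ht : ∀ M : Matrix (Fin N) (Fin N) F, N - M.rank ∈ S → N - M.rank ∈ t) :
    corankProb F N S = ∑ k ∈ t with k ∈ S, corankProb F N {k} := by
  simp only [corankProb, ← sum_div, ← Nat.cast_sum]
  congr 2
  rw [card_eq_sum_card_fiberwise (f := fun M => N - M.rank) (t := {k ∈ t | k ∈ S})
    (fun M hM => by
      simp only [coe_filter, mem_univ, true_and, Set.mem_ofPred_eq] at hM ⊢
      exact ⟨ht M hM, hM⟩)]
  refine sum_congr rfl fun k hk => ?_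
  rw [filter_filter]
  congr 1
  ext M
  simp only [mem_filter, mem_univ, true_and, Set.mem_singleton_iff, and_iff_right_iff_imp]
  rintro rfl
  exact (mem_filter.1 hk).2

lemma Qinf_nonneg (k : ℕ) : 0 ≤ Qinf (Fintype.card F) k := by
  have hq := two_le_card_real F
  have := qProdInf_pos hq
  rw [Qinf_eq hq]
  positivity

lemma sum_Qinf_le_one (t : Finset ℕ) : ∑ k ∈ t, Qinf (Fintype.card F) k ≤ 1 := by
  classical
  refine le_of_tendsto (tendsto_finsetSum t fun k _ => tendsto_corankProb F k)
    (Eventually.of_forall fun N => ?_)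
  have h := corankProb_eq_sum F N (t : Set ℕ) t fun M h => h
  simp only [mem_coe, filter_mem_eq_inter, inter_self] at h
  rw [← h]
  exact corankProb_le_one F N _

lemma summable_Qinf : Summable (Qinf (Fintype.card F)) :=
  summable_of_sum_le (Qinf_nonneg F) (sum_Qinf_le_one F)

lemma tsum_Qinf_add_tsum_compl_le_one (S : Set ℕ) :
    ∑' k : S, Qinf (Fintype.card F) k + ∑' k : (Sᶜ : Set ℕ), Qinf (Fintype.card F) k ≤ 1 := by
  rw [(summable_Qinf F).tsum_subtype_add_tsum_subtype_compl]
  exact Real.tsum_le_of_sum_le (Qinf_nonneg F) (sum_Qinf_le_one F)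

lemma tsum_subtype_Qinf_nonneg (S : Set ℕ) : 0 ≤ ∑' k : S, Qinf (Fintype.card F) k :=
  tsum_nonneg fun _ => Qinf_nonneg F _

lemma tsum_subtype_Qinf_le_one (S : Set ℕ) : ∑' k : S, Qinf (Fintype.card F) k ≤ 1 := by
  linarith [tsum_Qinf_add_tsum_compl_le_one F S, tsum_subtype_Qinf_nonneg F Sᶜ]

/-- One-sided comparison of the corank law of uniform `N × N` matrices with the limit law. -/
lemma corankProb_le_tsum_Qinf_add (N : ℕ) (S : Set ℕ) :
    corankProb F N S ≤ ∑' k : S, Qinf (Fintype.card F) k + 2 * ((Fintype.card F : ℝ) ^ N)⁻¹ := by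
  classical
  have h0 := tsum_subtype_Qinf_nonneg F S
  rcases N with _ | N
  · have := corankProb_le_one F 0 S
    norm_num
    linarith
  have h := corankProb_eq_sum F (N + 1) S (range (N + 2)) fun M _ => mem_range.2 (by omega)
  have hfin : ∑ k ∈ range (N + 2) with k ∈ S, Qinf (Fintype.card F) k ≤
      ∑' k : S, Qinf (Fintype.card F) k := by
    rw [_root_.tsum_subtype S (Qinf (Fintype.card F)), sum_filter]
    refine le_trans (le_of_eq ?_) (((summable_Qinf F).indicator S).sum_le_tsum (range (N + 2))
      fun k _ => Set.indicator_nonneg (fun k _ => Qinf_nonneg F k) k)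
    exact sum_congr rfl fun k _ => rfl
  have hx : 0 ≤ ((Fintype.card F : ℝ) ^ (N + 1))⁻¹ := by positivity
  have h1 := tsum_subtype_Qinf_le_one F S
  calc corankProb F (N + 1) S
      ≤ ∑ k ∈ range (N + 2) with k ∈ S,
          Qinf (Fintype.card F) k * (1 + 2 * ((Fintype.card F : ℝ) ^ (N + 1))⁻¹) := by
        rw [h]
        refine sum_le_sum fun k hk => corankProb_le_Qinf F N k ?_
        have := mem_range.1 (mem_filter.1 hk).1
        omega
    _ ≤ _ := by
        rw [← sum_mul]
        nlinarith

end Corank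

section Corner

open Classical in
lemma card_GL_toBlocks_top_le {α β F : Type*} [Fintype α] [DecidableEq α] [Fintype β] [DecidableEq β]
    [Field F] [Fintype F]
    (M : Matrix α α F) (B : Matrix α β F) :
    #{A : GL (α ⊕ β) F | A.1.toBlocks₁₁ = M ∧ A.1.toBlocks₁₂ = B} ≤
      Fintype.card (Matrix β α F) * Fintype.card (GL β F) := by
  rcases eq_empty_or_nonempty
    {A : GL (α ⊕ β) F | A.1.toBlocks₁₁ = M ∧ A.1.toBlocks₁₂ = B} with h | ⟨A₀, hA₀⟩
  · simp [h]
  simp only [mem_filter, mem_univ, true_and] at hA₀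
  have key : ∀ A : GL (α ⊕ β) F, A.1.toBlocks₁₁ = M → A.1.toBlocks₁₂ = B →
      (A * A₀⁻¹).1 = fromBlocks 1 0 (A * A₀⁻¹).1.toBlocks₂₁ (A * A₀⁻¹).1.toBlocks₂₂ := by
    intro A h1 h2
    have hrow : ∀ i, A.1 (Sum.inl i) = A₀.1 (Sum.inl i) := by
      intro i
      funext j
      rcases j with j | j
      · exact congrFun (congrFun (h1.trans hA₀.1.symm) i) j
      · exact congrFun (congrFun (h2.trans hA₀.2.symm) i) j
    have hone : ∀ i j, (A * A₀⁻¹).1 (Sum.inl i) j =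
        (1 : Matrix (α ⊕ β) (α ⊕ β) F) (Sum.inl i) j := by
      intro i j
      have h3 : (A₀ * A₀⁻¹).1 = 1 := by simp
      rw [← h3, Units.val_mul, Units.val_mul, Matrix.mul_apply, Matrix.mul_apply, hrow]
    ext i j
    rcases i with i | i
    · rw [hone]
      rcases j with j | j <;> simp [Matrix.one_apply]
    · rcases j with j | j <;> rfl
  have hcard : #((univ : Finset (Matrix β α F)) ×ˢ
      (univ : Finset (GL β F)).image (Units.val : GL β F → Matrix β β F)) ≤
      Fintype.card (Matrix β α F) * Fintype.card (GL β F) := by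
    rw [card_product, card_univ]
    exact Nat.mul_le_mul_left _ card_image_le
  refine le_trans (card_le_card_of_injOn
    (fun A => ((A * A₀⁻¹).1.toBlocks₂₁, (A * A₀⁻¹).1.toBlocks₂₂)) ?_ ?_) hcard
  · intro A hA
    simp only [coe_filter, mem_univ, true_and, Set.mem_ofPred_eq] at hA
    have hu : IsUnit (A * A₀⁻¹).1 := Units.isUnit _
    rw [key A hA.1 hA.2, isUnit_fromBlocks_zero₁₂] at hu
    obtain ⟨u, hu⟩ := hu.2
    simp only [mem_coe, mem_product, mem_univ, true_and, mem_image]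
    exact ⟨u, hu⟩
  · intro A hA A' hA' h
    simp only [coe_filter, mem_univ, true_and, Set.mem_ofPred_eq] at hA hA'
    simp only [Prod.mk.injEq] at h
    refine mul_right_cancel (b := A₀⁻¹) (Units.ext ?_)
    rw [key A hA.1 hA.2, key A' hA'.1 hA'.2, h.1, h.2]

open Classical in
lemma card_GL_toBlocks₁₁_le {α β F : Type*} [Fintype α] [DecidableEq α] [Fintype β] [DecidableEq β]
    [Field F] [Fintype F]
    (M : Matrix α α F) :
    #{A : GL (α ⊕ β) F | A.1.toBlocks₁₁ = M} ≤
      Fintype.card (Matrix β α F) * Fintype.card (GL β F) * Fintype.card (Matrix α β F) := by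
  rw [← card_univ (α := Matrix α β F)]
  refine card_le_mul_card_image_of_maps_to (f := fun A : GL (α ⊕ β) F => A.1.toBlocks₁₂)
    (fun A _ => mem_univ _) _ fun B _ => ?_
  rw [filter_filter]
  exact card_GL_toBlocks_top_le M B

open Classical in
lemma card_GL_corner_le {F : Type*} [Field F] [Fintype F] {N m : ℕ} (h : N ≤ N + m)
    (M : Matrix (Fin N) (Fin N) F) :
    #{A : GL (Fin (N + m)) F | A.1.submatrix (Fin.castLE h) (Fin.castLE h) = M} ≤
      Fintype.card F ^ (m * N) * Fintype.card (GL (Fin m) F) * Fintype.card F ^ (N * m) := by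
  have hm : ∀ (a b : ℕ) [Fintype (Matrix (Fin a) (Fin b) F)],
      Fintype.card (Matrix (Fin a) (Fin b) F) = Fintype.card F ^ (a * b) := by
    intro a b _
    rw [← Nat.card_eq_fintype_card]
    simp [Matrix, ← pow_mul, mul_comm]
  have hle := card_GL_toBlocks₁₁_le (β := Fin m) M
  rw [hm, hm] at hle
  refine le_trans ?_ hle
  let e := Units.mapEquiv
    (reindexAlgEquiv F F (finSumFinEquiv (m := N) (n := m)).symm).toMulEquiv
  refine card_le_card_of_injOn e ?_ e.injective.injOn
  intro A hA
  simp only [coe_filter, mem_univ, true_and, Set.mem_ofPred_eq] at hA ⊢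
  rw [← hA]
  rfl

lemma card_GL_eq_qProd (F : Type*) [Field F] [Fintype F] (n : ℕ) :
    (Nat.card (GL (Fin n) F) : ℝ) =
      (Fintype.card F : ℝ) ^ (n * n) * qProd (Fintype.card F) n := by
  have hq := two_le_card_real F
  have h := qDesc_mul_qProd hq 0 n
  simp only [zero_add, show qProd (Fintype.card F : ℝ) 0 = 1 from prod_range_zero _, mul_one] at h
  rw [← h, card_GL_field, Nat.cast_prod, qDesc, ← Fin.prod_univ_eq_prod_range
    (fun i => (Fintype.card F : ℝ) ^ n - (Fintype.card F : ℝ) ^ i)]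
  refine prod_congr rfl fun i _ => ?_
  rw [Nat.cast_sub (Nat.pow_le_pow_right Fintype.card_pos i.2.le), Nat.cast_pow, Nat.cast_pow]

open Classical in
/-- One-sided comparison of the corank law of the corner of a uniform element of `GL_{N+m}` with
that of a uniform matrix. -/
lemma card_GL_corner_corank_div_le {F : Type*} [Field F] [Fintype F] {N m : ℕ} (h : N ≤ N + m)
    (S : Set ℕ) :
    (#{A : GL (Fin (N + m)) F |
        N - (A.1.submatrix (Fin.castLE h) (Fin.castLE h)).rank ∈ S} : ℝ) /
        Nat.card (GL (Fin (N + m)) F) ≤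
      corankProb F N S + 2 * ((Fintype.card F : ℝ) ^ m)⁻¹ := by
  have hq := two_le_card_real F
  have h0 := corankProb_nonneg F N S
  rcases m with _ | m
  · refine le_trans (b := 1) ?_ (by norm_num; linarith)
    rw [Nat.card_eq_fintype_card]
    exact div_le_one_of_le₀ (Nat.cast_le.2 (card_le_univ _)) (Nat.cast_nonneg _)
  have hc : #{A : GL (Fin (N + (m + 1))) F |
        N - (A.1.submatrix (Fin.castLE h) (Fin.castLE h)).rank ∈ S} ≤
      Fintype.card F ^ ((m + 1) * N) * Fintype.card (GL (Fin (m + 1)) F) *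
        Fintype.card F ^ (N * (m + 1)) *
        #{M : Matrix (Fin N) (Fin N) F | N - M.rank ∈ S} := by
    refine card_le_mul_card_image_of_maps_to
      (f := fun A : GL (Fin (N + (m + 1))) F => A.1.submatrix (Fin.castLE h) (Fin.castLE h))
      (fun A hA => ?_) _ fun M _ => ?_
    · simpa using hA
    · exact (card_le_card (filter_subset_filter _ (filter_subset _ _))).trans
        (card_GL_corner_le h M)
  rw [← Nat.card_eq_fintype_card (α := GL (Fin (m + 1)) F)] at hc
  have hc' := Nat.cast_le (α := ℝ).2 hc
  push_cast at hc'
  have hφ : qProd (Fintype.card F) (m + 1) ≤ qProd (Fintype.card F) (N + (m + 1)) *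
      (1 + 2 * ((Fintype.card F : ℝ) ^ (m + 1))⁻¹) := by
    refine le_mul_one_add_of_mul_one_sub_le (qProd_pos hq _) (by positivity)
      (inv_pow_succ_le_half hq m) ?_
    rw [add_comm N]
    refine le_trans ?_ (qProd_add_ge hq (m + 1) N)
    have : 0 < ((Fintype.card F : ℝ) ^ (m + 1 + N))⁻¹ := by positivity
    exact mul_le_mul_of_nonneg_left (by linarith) (qProd_pos hq _).le
  have hpos := qProd_pos hq (N + (m + 1))
  have hx : 0 ≤ ((Fintype.card F : ℝ) ^ (m + 1))⁻¹ := by positivity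
  have h1 := corankProb_le_one F N S
  have hU : (#{M : Matrix (Fin N) (Fin N) F | N - M.rank ∈ S} : ℝ) =
      corankProb F N S * (Fintype.card F : ℝ) ^ (N ^ 2) := by
    rw [corankProb, div_mul_cancel₀ _ (by positivity)]
  rw [hU, card_GL_eq_qProd] at hc'
  rw [card_GL_eq_qProd, div_le_iff₀ (by positivity)]
  calc _ ≤ _ := hc'
    _ = (Fintype.card F : ℝ) ^ ((N + (m + 1)) * (N + (m + 1))) * corankProb F N S *
        qProd (Fintype.card F) (m + 1) := by ring
    _ ≤ (Fintype.card F : ℝ) ^ ((N + (m + 1)) * (N + (m + 1))) * corankProb F N S *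
        (qProd (Fintype.card F) (N + (m + 1)) *
          (1 + 2 * ((Fintype.card F : ℝ) ^ (m + 1))⁻¹)) := by gcongr
    _ = corankProb F N S * (1 + 2 * ((Fintype.card F : ℝ) ^ (m + 1))⁻¹) *
        ((Fintype.card F : ℝ) ^ ((N + (m + 1)) * (N + (m + 1))) *
          qProd (Fintype.card F) (N + (m + 1))) := by ring
    _ ≤ _ := by
        gcongr
        nlinarith

end Corner

open Classical in
lemma toReal_preimage_le_of_uniform {Ω G : Type*} [MeasurableSpace Ω] (μ : Measure Ω)
    [Fintype G] (X : Ω → G) (hX : ∀ g, μ {ω | X ω = g} = ((Nat.card G : ENNReal))⁻¹) (T : Set G) :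
    (μ (X ⁻¹' T)).toReal ≤ #{g | g ∈ T} / (Nat.card G : ℝ) := by
  rcases isEmpty_or_nonempty G with hG | hG
  · have : X ⁻¹' T = ∅ := Set.eq_empty_of_forall_notMem fun ω => hG.elim (X ω)
    rw [this]
    simp
  have hT : X ⁻¹' T ⊆ ⋃ g ∈ ({g | g ∈ T} : Finset G), {ω | X ω = g} := by
    intro ω hω
    simpa using hω
  have h := (measure_mono hT).trans (measure_biUnion_finset_le (μ := μ) _ _)
  simp only [hX, sum_const, nsmul_eq_mul] at h
  have hne : (Nat.card G : ENNReal) ≠ 0 := by exact_mod_cast Nat.card_pos.ne'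
  have hfin : (#{g | g ∈ T} : ENNReal) * (Nat.card G : ENNReal)⁻¹ ≠ ⊤ :=
    ENNReal.mul_ne_top (ENNReal.natCast_ne_top _) (ENNReal.inv_ne_top.2 hne)
  have h' := ENNReal.toReal_mono hfin h
  simpa [div_eq_mul_inv] using h'

/-- If a law satisfies a one-sided bound against `Q_∞` on every set, the total variation distance
satisfies the same bound. -/
lemma tvDist_Qinf_le {F : Type*} [Field F] [Fintype F] {Ω : Type*} [MeasureSpace Ω]
    [IsProbabilityMeasure (ℙ : Measure Ω)] (Q : Ω → ℕ) {b : ℝ} (hb : 0 ≤ b)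
    (h : ∀ S : Set ℕ, (ℙ (Q ⁻¹' S)).toReal ≤ ∑' k : S, Qinf (Fintype.card F) k + b) :
    tvDist Q (Qinf (Fintype.card F)) ≤ b := by
  refine Real.iSup_le (fun S => abs_le.2 ⟨?_, by linarith [h S]⟩) hb
  have h1 : (1 : ENNReal) ≤ ℙ (Q ⁻¹' S) + ℙ (Q ⁻¹' Sᶜ) := by
    rw [← measure_univ (μ := (ℙ : Measure Ω)), ← Set.preimage_univ (f := Q),
      ← Set.union_compl_self S, Set.preimage_union]
    exact measure_union_le _ _
  have h2 := ENNReal.toReal_mono (by finiteness) h1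
  rw [ENNReal.toReal_add (measure_ne_top _ _) (measure_ne_top _ _), ENNReal.toReal_one] at h2
  linarith [h Sᶜ, tsum_Qinf_add_tsum_compl_le_one F S]

lemma two_mul_inv_pow_le_rpow {q x y : ℝ} (hq : 2 ≤ q) {m : ℕ} (hx : 0 ≤ x) (hy : 0 ≤ y)
    (hxm : x ≤ m) : 2 * (q ^ m)⁻¹ ≤ (2 : ℝ) ^ (min y x + 1) / q ^ x := by
  have hq0 : 0 < q := by linarith
  rw [← div_eq_mul_inv]
  refine div_le_div₀ (by positivity) ?_ (by positivity) ?_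
  · calc (2 : ℝ) = (2 : ℝ) ^ (1 : ℝ) := (Real.rpow_one 2).symm
      _ ≤ _ := Real.rpow_le_rpow_of_exponent_le one_le_two (by linarith [le_min hy hx])
  · rw [← Real.rpow_natCast]
    exact Real.rpow_le_rpow_of_exponent_le (by linarith) hxm

end

/-- **Corner of `GL_n`:** the corank of the upper-left `n' × n'` corner of a uniform element of
`GL_n(F_q)`, where `n' ≤ (1 − ε)n`, is close to `Q_∞` in total variation. -/
theorem rank_GL_corner
    (ε : ℝ) (hε : 0 < ε) (n n' : ℕ) (hn' : n' ≤ n) (hn'ε : (n' : ℝ) ≤ (1 - ε) * n)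
    (F : Type) [Field F] [Fintype F] [DecidableEq F]
    (Ω : Type) [MeasureSpace Ω] (hprob : IsProbabilityMeasure (ℙ : Measure Ω))
    (A : Ω → GL (Fin n) F)
    -- A is uniformly distributed on GL_n(F_q)
    (hunif : ∀ B : GL (Fin n) F,
      ℙ {ω | A ω = B} = ((Fintype.card (GL (Fin n) F) : ENNReal))⁻¹) :
    tvDist
        (fun ω => n' -
          ((A ω : Matrix (Fin n) (Fin n) F).submatrix (Fin.castLE hn') (Fin.castLE hn')).rank)
        (Qinf (Fintype.card F)) ≤
      3 / (Fintype.card F : ℝ) ^ (n' : ℕ) +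
        (2 : ℝ) ^ (min (n' : ℝ) (ε * n) + 1) / (Fintype.card F : ℝ) ^ (ε * n) := by
  classical
  obtain ⟨m, rfl⟩ := Nat.exists_eq_add_of_le hn'
  have hq := two_le_card_real F
  have hεm : ε * ((n' + m : ℕ) : ℝ) ≤ m := by
    push_cast at hn'ε ⊢
    linarith
  have hm := two_mul_inv_pow_le_rpow hq (y := n') (by positivity) (by positivity) hεm
  refine le_trans (tvDist_Qinf_le (F := F) _ (b := 2 * ((Fintype.card F : ℝ) ^ n')⁻¹ +
    2 * ((Fintype.card F : ℝ) ^ m)⁻¹) (by positivity) fun S => ?_) ?_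
  · have h := toReal_preimage_le_of_uniform ℙ A
      (fun B => by rw [hunif B, Nat.card_eq_fintype_card])
      {B | n' - (B.1.submatrix (Fin.castLE hn') (Fin.castLE hn')).rank ∈ S}
    have h1 := card_GL_corner_corank_div_le (F := F) hn' S
    have h2 := corankProb_le_tsum_Qinf_add F n' S
    refine h.trans ?_
    refine le_trans (le_of_eq ?_) (h1.trans (by linarith))
    congr!
  · have : 0 ≤ ((Fintype.card F : ℝ) ^ n')⁻¹ := by positivity
    rw [div_eq_mul_inv 3]
    linarith
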